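/- Let g be the symmetric bilinear form on n_{−2} ≅ R^8 (with basis X_1,…,X_8 of n_{E_III}) with matrix diag(−1,−1,−1,−1,−1,−1,−1,1). Then g is nondegenerate of signature (1,7), and for every strata-preserving derivation A of n_{E_III} there exists a scalar λ(A) ∈ R such that g(A v, w) + g(v, A w) = λ(A)·g(v,w) for all v,w ∈ n_{−2}; i.e. the degree-zero part of the Tanaka prolongation of n_{E_III} acts on n_{−2} as a subalgebra of the conformal orthogonal algebra co(1,7). -/

import Mathlib

noncomputable section
open ComplexConjugate

/-- Points of `ℝ²⁴`, with coordinates `u^i = p (i-1)`, `x^i = p (7+i)`, `y^i = p (15+i)`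
for `i = 1, …, 8`. -/
abbrev Pt : Type := Fin 24 → ℝ
/-- The bracket of the 24-dimensional 2-step nilpotent Lie algebra `n_{E_III}`, in the
basis `X_1, …, X_24` (indexed here by `0, …, 23`): for each term `ε·λ^B∧λ^D` in the E_III
structure equations one has `[X_B, X_D] = -ε·X_A`, and `X_1, …, X_8` are central. -/
def br (v w : Pt) : Pt := fun k =>
  if h : (k : ℕ) < 8 then
    (![-((v 8 * w 23 - v 23 * w 8) + (v 9 * w 19 - v 19 * w 9)
        + (v 10 * w 22 - v 22 * w 10) + (v 11 * w 17 - v 17 * w 11)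
        + (v 12 * w 21 - v 21 * w 12) + (v 13 * w 20 - v 20 * w 13)
        + (v 14 * w 18 - v 18 * w 14) + (v 15 * w 16 - v 16 * w 15)),
       -((v 8 * w 19 - v 19 * w 8) + (v 23 * w 9 - v 9 * w 23)
        + (v 21 * w 10 - v 10 * w 21) + (v 11 * w 16 - v 16 * w 11)
        + (v 12 * w 22 - v 22 * w 12) + (v 18 * w 13 - v 13 * w 18)
        + (v 14 * w 20 - v 20 * w 14) + (v 17 * w 15 - v 15 * w 17)),
       -((v 8 * w 22 - v 22 * w 8) + (v 9 * w 21 - v 21 * w 9)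
        + (v 23 * w 10 - v 10 * w 23) + (v 20 * w 11 - v 11 * w 20)
        + (v 19 * w 12 - v 12 * w 19) + (v 13 * w 17 - v 17 * w 13)
        + (v 14 * w 16 - v 16 * w 14) + (v 18 * w 15 - v 15 * w 18)),
       -((v 9 * w 8 - v 8 * w 9) + (v 12 * w 10 - v 10 * w 12)
        + (v 15 * w 11 - v 11 * w 15) + (v 14 * w 13 - v 13 * w 14)
        + (v 17 * w 16 - v 16 * w 17) + (v 20 * w 18 - v 18 * w 20)
        + (v 23 * w 19 - v 19 * w 23) + (v 22 * w 21 - v 21 * w 22)),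
       -((v 8 * w 21 - v 21 * w 8) + (v 22 * w 9 - v 9 * w 22)
        + (v 10 * w 19 - v 19 * w 10) + (v 11 * w 18 - v 18 * w 11)
        + (v 23 * w 12 - v 12 * w 23) + (v 13 * w 16 - v 16 * w 13)
        + (v 17 * w 14 - v 14 * w 17) + (v 20 * w 15 - v 15 * w 20)),
       -((v 12 * w 8 - v 8 * w 12) + (v 10 * w 9 - v 9 * w 10)
        + (v 11 * w 14 - v 14 * w 11) + (v 15 * w 13 - v 13 * w 15)
        + (v 20 * w 16 - v 16 * w 20) + (v 18 * w 17 - v 17 * w 18)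
        + (v 19 * w 22 - v 22 * w 19) + (v 23 * w 21 - v 21 * w 23)),
       -((v 10 * w 8 - v 8 * w 10) + (v 9 * w 12 - v 12 * w 9)
        + (v 13 * w 11 - v 11 * w 13) + (v 15 * w 14 - v 14 * w 15)
        + (v 18 * w 16 - v 16 * w 18) + (v 17 * w 20 - v 20 * w 17)
        + (v 21 * w 19 - v 19 * w 21) + (v 23 * w 22 - v 22 * w 23)),
       -((v 8 * w 16 - v 16 * w 8) + (v 9 * w 17 - v 17 * w 9)
        + (v 10 * w 18 - v 18 * w 10) + (v 11 * w 19 - v 19 * w 11)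
        + (v 12 * w 20 - v 20 * w 12) + (v 13 * w 21 - v 21 * w 13)
        + (v 14 * w 22 - v 22 * w 14) + (v 15 * w 23 - v 23 * w 15))] : Fin 8 → ℝ) ⟨k, h⟩
  else 0
/-- The stratum `n_{-2} = span (X_1, …, X_8)`. -/
def Nm2 : Submodule ℝ Pt where
  carrier := {v | ∀ k : Fin 24, 8 ≤ (k : ℕ) → v k = 0}
  add_mem' := by
    intro a b ha hb
    simp only [Set.mem_setOf_eq] at ha hb ⊢
    intro k hk
    simp [Pi.add_apply, ha k hk, hb k hk]
  zero_mem' := by intro k _; rfl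
  smul_mem' := by
    intro c v hv
    simp only [Set.mem_setOf_eq] at hv ⊢
    intro k hk
    simp [Pi.smul_apply, hv k hk]

/-- The stratum `n_{-1} = span (X_9, …, X_24)`. -/
def Nm1 : Submodule ℝ Pt where
  carrier := {v | ∀ k : Fin 24, (k : ℕ) < 8 → v k = 0}
  add_mem' := by
    intro a b ha hb
    simp only [Set.mem_setOf_eq] at ha hb ⊢
    intro k hk
    simp [Pi.add_apply, ha k hk, hb k hk]
  zero_mem' := by intro k _; rfl
  smul_mem' := by
    intro c v hv
    simp only [Set.mem_setOf_eq] at hv ⊢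
    intro k hk
    simp [Pi.smul_apply, hv k hk]
/-- A strata-preserving derivation: a linear endomorphism `A` with `A (n_{-1}) ⊆ n_{-1}`,
`A (n_{-2}) ⊆ n_{-2}`, and `A [v, w] = [A v, w] + [v, A w]`. -/
def IsSPDer (A : Module.End ℝ Pt) : Prop :=
  (∀ v ∈ Nm1, A v ∈ Nm1) ∧ (∀ v ∈ Nm2, A v ∈ Nm2) ∧
    ∀ v w : Pt, A (br v w) = br (A v) w + br v (A w)

/-- The symmetric bilinear form on `n_{-2} ≅ ℝ⁸` with matrix
`diag (-1, -1, -1, -1, -1, -1, -1, 1)` (in the basis `X_1, …, X_8`, indexed here by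
`0, …, 7`). -/
def gForm (v w : Pt) : ℝ :=
  -(v 0 * w 0) - v 1 * w 1 - v 2 * w 2 - v 3 * w 3 - v 4 * w 4 - v 5 * w 5
    - v 6 * w 6 + v 7 * w 7

/-- For `b : Fin 16` and `k : Fin 8`, the index `partner k b` is the unique `d` for which
`[X_{9+b}, X_{9+d}]` has a nonzero component along `X_{1+k}`. -/
def partner : Fin 8 → Fin 16 → Fin 16 :=
  ![![15, 11, 14, 9, 13, 12, 10, 8, 7, 3, 6, 1, 5, 4, 2, 0],
    ![11, 15, 13, 8, 14, 10, 12, 9, 3, 7, 5, 0, 6, 2, 4, 1],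
    ![14, 13, 15, 12, 11, 9, 8, 10, 6, 5, 7, 4, 3, 1, 0, 2],
    ![1, 0, 4, 7, 2, 6, 5, 3, 9, 8, 12, 15, 10, 14, 13, 11],
    ![13, 14, 11, 10, 15, 8, 9, 12, 5, 6, 3, 2, 7, 0, 1, 4],
    ![4, 2, 1, 6, 0, 7, 3, 5, 12, 10, 9, 14, 8, 15, 11, 13],
    ![2, 4, 0, 5, 1, 3, 7, 6, 10, 12, 8, 13, 9, 11, 15, 14],
    ![8, 9, 10, 11, 12, 13, 14, 15, 0, 1, 2, 3, 4, 5, 6, 7]]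

/-- The component of `[X_{9+b}, X_{9+d}]` along `X_{1+k}`, where `d = partner k b`. -/
def structSign : Fin 8 → Fin 16 → ℤ :=
  ![![-1, -1, -1, -1, -1, -1, -1, -1, 1, 1, 1, 1, 1, 1, 1, 1],
    ![-1, 1, 1, -1, -1, 1, -1, 1, 1, -1, -1, 1, 1, -1, 1, -1],
    ![-1, -1, 1, 1, 1, -1, -1, 1, 1, 1, -1, -1, -1, 1, 1, -1],
    ![1, -1, 1, 1, -1, 1, -1, -1, 1, -1, 1, 1, -1, 1, -1, -1],
    ![-1, 1, -1, -1, 1, -1, 1, 1, 1, -1, 1, 1, -1, 1, -1, -1],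
    ![1, 1, -1, -1, -1, 1, 1, -1, 1, 1, -1, -1, -1, 1, 1, -1],
    ![1, -1, -1, 1, 1, -1, 1, -1, 1, -1, -1, 1, 1, -1, 1, -1],
    ![-1, -1, -1, -1, -1, -1, -1, -1, 1, 1, 1, 1, 1, 1, 1, 1]]

/-- The diagonal entries of the matrix of `gForm`. -/
def gSign (i : Fin 8) : ℤ := if i = 7 then 1 else -1

/-- The basis vectors `X_1, …, X_8` of `n_{-2}`. -/
def centralVec (k : Fin 8) : Pt := Pi.single (Fin.castAdd 16 k) 1

/-- The basis vectors `X_9, …, X_24` of `n_{-1}`. -/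
def generatorVec (b : Fin 16) : Pt := Pi.single (Fin.natAdd 8 b) 1

theorem partner_partner_comm : ∀ i j b, partner i (partner j b) = partner j (partner i b) := by
  decide

theorem partner_involutive : ∀ i, Function.Involutive (partner i) := by
  unfold Function.Involutive
  decide

theorem partner_left_inj : ∀ b i j, partner i b = partner j b ↔ i = j := by
  decide

theorem structSign_mul_self : ∀ i b, structSign i b * structSign i b = 1 := by
  decide

theorem structSign_partner : ∀ i b, structSign i (partner i b) = -structSign i b := by
  decide

/-- The operators `X_b ↦ structSign i b • X_{partner i b}` for distinct `i`, `j` commute or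
anticommute according to the signs of `g`. -/
theorem structSign_clifford : ∀ i j, i ≠ j → ∀ b,
    gSign i * (structSign j b * structSign i (partner j b))
      + gSign j * (structSign i b * structSign j (partner i b)) = 0 := by
  decide

theorem structSign_opposite : ∀ i j, i ≠ j → ∀ b,
    gSign i * (structSign j b * structSign i b)
      + gSign j * (structSign j (partner i (partner j b)) *
          structSign i (partner i (partner j b))) = 0 := by
  decide

theorem centralVec_castAdd (k i : Fin 8) :
    centralVec k (Fin.castAdd 16 i) = if i = k then 1 else 0 := by
  simp [centralVec, Pi.single_apply, Fin.ext_iff]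

theorem centralVec_natAdd (k : Fin 8) (b : Fin 16) : centralVec k (Fin.natAdd 8 b) = 0 := by
  have h : 8 + (b : ℕ) ≠ k := by omega
  simp [centralVec, Fin.ext_iff, h]

theorem generatorVec_natAdd (b d : Fin 16) :
    generatorVec b (Fin.natAdd 8 d) = if d = b then 1 else 0 := by
  simp [generatorVec, Pi.single_apply, Fin.ext_iff]

theorem centralVec_mem_Nm2 (k : Fin 8) : centralVec k ∈ Nm2 := by
  intro i hi
  have h : (i : ℕ) ≠ k := by omega
  simp [centralVec, Fin.ext_iff, h]

theorem linearIndependent_centralVec : LinearIndependent ℝ centralVec := by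
  convert (Pi.basisFun ℝ (Fin 24)).linearIndependent.comp _ (Fin.castAdd_injective 8 16) using 1
  funext k
  simp [centralVec]

theorem eq_sum_centralVec {v : Pt} (hv : v ∈ Nm2) :
    v = ∑ k, v (Fin.castAdd 16 k) • centralVec k := by
  funext i
  induction i using Fin.addCases (m := 8) (n := 16) with
  | left i => simp [Finset.sum_apply, centralVec_castAdd]
  | right i => simp [Finset.sum_apply, centralVec_natAdd, hv (Fin.natAdd 8 i) (by simp)]

theorem gForm_eq_sum (v w : Pt) :
    gForm v w = ∑ i, gSign i * (v (Fin.castAdd 16 i) * w (Fin.castAdd 16 i)) := by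
  simp [gForm, gSign, Fin.sum_univ_eight, sub_eq_add_neg]

/-- The form `gForm` as a bilinear map. -/
def gBilin : LinearMap.BilinForm ℝ Pt :=
  LinearMap.mk₂ ℝ gForm
    (fun v v' w => by simp only [gForm, Pi.add_apply]; ring)
    (fun c v w => by simp only [gForm, Pi.smul_apply, smul_eq_mul]; ring)
    (fun v w w' => by simp only [gForm, Pi.add_apply]; ring)
    (fun c v w => by simp only [gForm, Pi.smul_apply, smul_eq_mul]; ring)

theorem gForm_centralVec (i j : Fin 8) :
    gForm (centralVec i) (centralVec j) = if i = j then (gSign i : ℝ) else 0 := by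
  rcases eq_or_ne i j with rfl | h
  · simp [gForm_eq_sum, centralVec_castAdd]
  · simp [gForm_eq_sum, centralVec_castAdd, h, h.symm]

theorem span_centralVec : Submodule.span ℝ (Set.range centralVec) = Nm2 := by
  apply le_antisymm
  · rw [Submodule.span_le]
    rintro _ ⟨k, rfl⟩
    exact centralVec_mem_Nm2 k
  · intro v hv
    rw [eq_sum_centralVec hv]
    exact Submodule.sum_mem _ fun k _ =>
      Submodule.smul_mem _ _ (Submodule.subset_span ⟨k, rfl⟩)

theorem br_swap (v w : Pt) : br w v = -br v w := by
  funext k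
  by_cases h : (k : ℕ) < 8
  · obtain ⟨i, rfl⟩ : ∃ i : Fin 8, k = Fin.castAdd 16 i := ⟨⟨k, h⟩, rfl⟩
    fin_cases i <;> simp [br] <;> ring
  · simp [br, h]

set_option maxHeartbeats 2000000 in
theorem br_generatorVec_left (b : Fin 16) (w : Pt) (k : Fin 8) :
    br (generatorVec b) w (Fin.castAdd 16 k) =
      structSign k b * w (Fin.natAdd 8 (partner k b)) := by
  fin_cases k <;> fin_cases b <;>
    simp [br, generatorVec, structSign, partner]

theorem br_generatorVec_right (b : Fin 16) (v : Pt) (k : Fin 8) :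
    br v (generatorVec b) (Fin.castAdd 16 k) =
      -(structSign k b * v (Fin.natAdd 8 (partner k b))) := by
  rw [br_swap, Pi.neg_apply, br_generatorVec_left]

theorem br_generatorVec_partner (j : Fin 8) (b : Fin 16) :
    br (generatorVec b) (generatorVec (partner j b)) = (structSign j b : ℝ) • centralVec j := by
  funext k
  induction k using Fin.addCases (m := 8) (n := 16) with
  | left i =>
    rw [br_generatorVec_left]
    by_cases h : i = j <;>
      simp [h, generatorVec_natAdd, centralVec_castAdd, partner_left_inj]
  | right i => simp [centralVec_natAdd, br]

namespace IsSPDer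

variable {A : Module.End ℝ Pt}

/-- The action of a derivation on `n_{-2}` is determined by its action on `n_{-1}`: this is the
derivation identity applied to the pair `X_{9+b}`, `X_{9+d}` with `d = partner j b`. -/
theorem apply_centralVec (hA : IsSPDer A) (i j : Fin 8) (b : Fin 16) :
    A (centralVec j) (Fin.castAdd 16 i) =
      structSign j b * structSign i b *
          A (generatorVec (partner j b)) (Fin.natAdd 8 (partner i b))
        - structSign j b * structSign i (partner j b) *
          A (generatorVec b) (Fin.natAdd 8 (partner i (partner j b))) := by
  have h := congrFun (hA.2.2 (generatorVec b) (generatorVec (partner j b))) (Fin.castAdd 16 i)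
  rw [br_generatorVec_partner, map_smul, Pi.smul_apply, smul_eq_mul, Pi.add_apply,
    br_generatorVec_left, br_generatorVec_right] at h
  have hs : (structSign j b * structSign j b : ℝ) = 1 := mod_cast structSign_mul_self j b
  linear_combination (structSign j b : ℝ) * h - A (centralVec j) (Fin.castAdd 16 i) * hs

theorem apply_centralVec_self (hA : IsSPDer A) (i : Fin 8) (b : Fin 16) :
    A (centralVec i) (Fin.castAdd 16 i) =
      A (generatorVec (partner i b)) (Fin.natAdd 8 (partner i b))
        + A (generatorVec b) (Fin.natAdd 8 b) := by
  have hs : (structSign i b * structSign i b : ℝ) = 1 := mod_cast structSign_mul_self i b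
  rw [hA.apply_centralVec i i b, partner_involutive, structSign_partner]
  push_cast
  linear_combination (A (generatorVec (partner i b)) (Fin.natAdd 8 (partner i b))
    + A (generatorVec b) (Fin.natAdd 8 b)) * hs

/-- All diagonal entries of the action on `n_{-2}` agree. -/
theorem apply_centralVec_diag_eq (hA : IsSPDer A) (i j : Fin 8) :
    A (centralVec i) (Fin.castAdd 16 i) = A (centralVec j) (Fin.castAdd 16 j) := by
  have hi := hA.apply_centralVec_self i 0
  have hi' := hA.apply_centralVec_self i (partner j 0)
  have hj := hA.apply_centralVec_self j 0
  have hj' := hA.apply_centralVec_self j (partner i 0)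
  rw [partner_partner_comm j i] at hj'
  linarith

/-- The off-diagonal part of the action on `n_{-2}` is skew with respect to `g`. -/
theorem gSign_mul_apply_add (hA : IsSPDer A) {i j : Fin 8} (hij : i ≠ j) :
    gSign i * A (centralVec j) (Fin.castAdd 16 i)
      + gSign j * A (centralVec i) (Fin.castAdd 16 j) = 0 := by
  set e := partner i (partner j 0) with he
  have hie : partner i e = partner j 0 := partner_involutive i _
  have hje : partner j e = partner i 0 := by
    rw [he, partner_partner_comm i j, partner_involutive]
  have he' : partner j (partner i 0) = e := partner_partner_comm j i 0
  have h₁ := hA.apply_centralVec i j 0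
  have h₂ := hA.apply_centralVec i j e
  have h₃ := hA.apply_centralVec j i 0
  have h₄ := hA.apply_centralVec j i e
  have s₁ := congrArg (Int.cast (R := ℝ)) (structSign_opposite i j hij 0)
  have s₂ := congrArg (Int.cast (R := ℝ)) (structSign_opposite j i hij.symm 0)
  have s₃ := congrArg (Int.cast (R := ℝ)) (structSign_clifford i j hij 0)
  have s₄ := congrArg (Int.cast (R := ℝ)) (structSign_clifford i j hij e)
  simp only [← he, he', hie, hje, partner_involutive i 0, partner_involutive j 0,
    Int.cast_add, Int.cast_mul, Int.cast_zero] at h₁ h₂ h₃ h₄ s₁ s₂ s₃ s₄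
  linear_combination (gSign i / 2 : ℝ) * (h₁ + h₂) + (gSign j / 2 : ℝ) * (h₃ + h₄)
    + A (generatorVec (partner j 0)) (Fin.natAdd 8 (partner i 0)) / 2 * s₁
    + A (generatorVec (partner i 0)) (Fin.natAdd 8 (partner j 0)) / 2 * s₂
    - A (generatorVec 0) (Fin.natAdd 8 e) / 2 * s₃
    - A (generatorVec e) (Fin.natAdd 8 (0 : Fin 16)) / 2 * s₄

theorem gForm_apply_centralVec (hA : IsSPDer A) (i j : Fin 8) :
    gForm (A (centralVec i)) (centralVec j) + gForm (centralVec i) (A (centralVec j)) =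
      2 * A (centralVec 0) (Fin.castAdd 16 0) * gForm (centralVec i) (centralVec j) := by
  rw [gForm_centralVec, gForm_eq_sum, gForm_eq_sum]
  simp only [centralVec_castAdd, mul_ite, ite_mul, mul_one, one_mul, mul_zero, zero_mul,
    Finset.sum_ite_eq', Finset.mem_univ, if_true]
  split_ifs with h
  · subst h
    rw [hA.apply_centralVec_diag_eq i 0]
    ring
  · rw [add_comm, hA.gSign_mul_apply_add h]

end IsSPDer
/-- The form `g` on `n_{-2}` is symmetric, nondegenerate of signature `(1,7)`
(it admits an orthogonal basis of `n_{-2}` with 1 vector of square `+1` and 7 of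
square `-1`), and every strata-preserving derivation of `n_{E_III}` acts on `n_{-2}`
conformally with respect to `g`: the degree-zero part of the Tanaka prolongation acts on
`n_{-2}` as a subalgebra of `co(1,7)`. -/
theorem nEIII_derivations_act_conformally_co_1_7 :
    (∀ v w : Pt, gForm v w = gForm w v) ∧
    (∃ b : Fin 8 → Pt,
      (∀ i, b i ∈ Nm2) ∧ LinearIndependent ℝ b ∧
      Submodule.span ℝ (Set.range b) = Nm2 ∧
      ∀ i j, gForm (b i) (b j) =
        if i = j then (if (i : ℕ) < 1 then 1 else -1) else 0) ∧
    ∀ A : Module.End ℝ Pt, IsSPDer A →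
      ∃ lam : ℝ, ∀ v ∈ Nm2, ∀ w ∈ Nm2,
        gForm (A v) w + gForm v (A w) = lam * gForm v w := by
  refine ⟨fun v w => by simp [gForm, mul_comm], ⟨fun i => centralVec i.rev,
    fun i => centralVec_mem_Nm2 _, linearIndependent_centralVec.comp _ Fin.rev_injective,
    ?_, ?_⟩, fun A hA => ⟨2 * A (centralVec 0) (Fin.castAdd 16 0), fun v hv w hw => ?_⟩⟩
  · rw [← span_centralVec]
    exact congrArg _ (Fin.rev_surjective.range_comp centralVec)
  · intro i j
    rw [gForm_centralVec]
    simp only [Fin.rev_inj]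
    fin_cases i <;> simp [gSign]
  · have h : ∀ i j, gBilin (A (centralVec i)) (centralVec j)
        + gBilin (centralVec i) (A (centralVec j)) =
          2 * A (centralVec 0) (Fin.castAdd 16 0) * gBilin (centralVec i) (centralVec j) :=
      hA.gForm_apply_centralVec
    change gBilin (A v) w + gBilin v (A w) = _ * gBilin v w
    rw [eq_sum_centralVec hv, eq_sum_centralVec hw]
    simp only [map_sum, map_smul, LinearMap.sum_apply, LinearMap.smul_apply, Finset.mul_sum,
      ← Finset.sum_add_distrib, ← smul_add, h, mul_smul_comm]
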